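/- Let G = (X,E) be a tree of bounded degree without dead ends and z ∈ ℂ ∖ {0}. Then the edge Poisson transform P^e_z : D'(Ω) → Maps(E,ℂ) is a linear isomorphism from D'(Ω) onto the eigenspace E_z(Δᵉ; Maps(E,ℂ)) = ker(Δᵉ − z) ⊆ Maps(E,ℂ). -/

import Mathlib

open Function Set
open scoped Classical

namespace GraphQCC

variable {X : Type} (G : SimpleGraph X)

/-- The set of directed edges of a (symmetric, loopless) graph. -/
abbrev DE := {p : X × X // G.Adj p.1 p.2}

variable {G}

/-- Initial vertex of a directed edge. -/
def ini (e : DE G) : X := e.1.1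

/-- Terminal vertex of a directed edge. -/
def ter (e : DE G) : X := e.1.2

/-- Opposite edge. -/
def op (e : DE G) : DE G := ⟨(e.1.2, e.1.1), e.2.symm⟩

variable (G)

/-- Degree of a vertex: the number of directed edges starting at it. -/
noncomputable def deg (x : X) : ℕ := Set.ncard {e : DE G | ini e = x}

/-- The graph is locally finite: every vertex has finite degree. -/
def LocFin : Prop := ∀ x : X, {e : DE G | ini e = x}.Finite

/-- The edge Laplacian. -/
noncomputable def edgeLap (f : DE G → ℂ) (e : DE G) : ℂ :=
  ∑ᶠ e' ∈ {e' : DE G | ini e' = ter e ∧ e' ≠ op e}, f e'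

/-- The `z`-eigenspace of the edge Laplacian, as a set of functions on directed edges. -/
def edgeEig (z : ℂ) : Set (DE G → ℂ) := {f | ∀ e, edgeLap G f e = z * f e}

/-- The edge inversion operator Ξ. -/
def Xi (f : DE G → ℂ) (e : DE G) : ℂ := f (op e)

/-- The operator Σ (sum over edges with the same initial point). -/
noncomputable def Sig (f : DE G → ℂ) (e : DE G) : ℂ :=
  ∑ᶠ e' ∈ {e' : DE G | ini e' = ini e}, f e'

/-- Edges pointing away from a vertex `o`. -/
def away (o : X) : Set (DE G) := {e | G.dist o (ter e) = G.dist o (ini e) + 1}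

/-- The edge Laplacian on functions on the edges pointing away from `o`. -/
noncomputable def edgeLapAway (o : X) (f : ↥(away G o) → ℂ) (e : ↥(away G o)) : ℂ :=
  ∑ᶠ e' ∈ {e' : ↥(away G o) | ini e'.1 = ter e.1 ∧ e'.1 ≠ op e.1}, f e'

/-- The `z`-eigenspace of the edge Laplacian on edges pointing away from `o`. -/
def edgeEigAway (o : X) (z : ℂ) : Set (↥(away G o) → ℂ) :=
  {f | ∀ e, edgeLapAway G o f e = z * f e}

/-! ## Boundary at infinity -/

/-- A ray: an infinite non-backtracking chain of vertices. -/
def IsRay (r : ℕ → X) : Prop := (∀ n, G.Adj (r n) (r (n + 1))) ∧ ∀ n, r (n + 2) ≠ r n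

abbrev Ray := {r : ℕ → X // IsRay G r}

/-- Two rays are equivalent if they share infinitely many vertices. -/
def RayRel (r r' : Ray G) : Prop := (Set.range r.1 ∩ Set.range r'.1).Infinite

/-- The boundary at infinity: equivalence classes of rays. -/
def Boundary := Quot (RayRel G)

/-- The set `∂₊ e` of boundary points reachable by a non-backtracking chain starting with `e`. -/
def plusBd (e : DE G) : Set (Boundary G) :=
  {ω | ∃ r : Ray G, Quot.mk (RayRel G) r = ω ∧ r.1 0 = ini e ∧ r.1 1 = ter e}

/-- The topology on the boundary generated by the sets `∂₊ e`. -/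
instance : TopologicalSpace (Boundary G) :=
  TopologicalSpace.generateFrom {s | ∃ e : DE G, s = plusBd G e}

/-- The space of locally constant functions on the boundary. -/
noncomputable def Clc : Submodule ℂ (Boundary G → ℂ) where
  carrier := {f | IsLocallyConstant f}
  add_mem' hf hg := hf.comp₂ hg (· + ·)
  zero_mem' := IsLocallyConstant.const 0
  smul_mem' c f hf := hf.comp (c * ·)

/-- `D'(Ω)`: the algebraic dual of the space of locally constant functions on the boundary. -/
abbrev DualB := Module.Dual ℂ ↥(Clc G)

/-- Pairing of a functional on `C^lc(Ω)` with a function on the boundary. -/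
noncomputable def pairB (μ : DualB G) (g : Boundary G → ℂ) : ℂ :=
  if h : IsLocallyConstant g then μ ⟨g, h⟩ else 0

/-- The horocycle bracket `⟨x, ω⟩` with respect to the base point `o`: the unique integer `k`
such that `d(x, r n) = n - k` for every ray `r` from `o` representing `ω` and all large `n`. -/
noncomputable def horo (o x : X) (ω : Boundary G) : ℤ :=
  if h : ∃ k : ℤ, ∀ r : Ray G, Quot.mk (RayRel G) r = ω → r.1 0 = o →
      ∃ N : ℕ, ∀ n : ℕ, N ≤ n → (G.dist x (r.1 n) : ℤ) = (n : ℤ) - k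
  then h.choose else 0

/-- The scalar Poisson transform. -/
noncomputable def poisson (o : X) (z : ℂ) (μ : DualB G) (x : X) : ℂ :=
  pairB G μ fun ω => z ^ horo G o x ω

/-- The edge Poisson transform. -/
noncomputable def edgePoisson (o : X) (z : ℂ) (μ : DualB G) (e : DE G) : ℂ :=
  pairB G μ fun ω => z ^ horo G o (ini e) ω * Set.indicator (plusBd G e) 1 ω

/-! ## The shift space of non-backtracking chains of edges -/

/-- An infinite concatenated non-backtracking sequence of directed edges. -/
def IsChainSeq (c : ℕ → DE G) : Prop :=
  ∀ i, ter (c i) = ini (c (i + 1)) ∧ ter (c (i + 1)) ≠ ini (c i)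

/-- The shift space `𝔓`. -/
abbrev ChainSp := {c : ℕ → DE G // IsChainSeq G c}

/-- The one-sided shift on chains. -/
def shift (c : ChainSp G) : ChainSp G := ⟨fun n => c.1 (n + 1), fun i => c.2 (i + 1)⟩

/-- The district (cylinder) topology on the shift space. -/
instance : TopologicalSpace (ChainSp G) :=
  TopologicalSpace.generateFrom
    {s | ∃ (c₀ : ChainSp G) (n : ℕ), s = {c : ChainSp G | ∀ i ≤ n, c.1 i = c₀.1 i}}

/-- The Ruelle transfer operator. -/
noncomputable def transfer (F : ChainSp G → ℂ) (c : ChainSp G) : ℂ :=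
  ∑ᶠ c' ∈ {c' : ChainSp G | shift G c' = c}, F c'

/-- Functions on chains depending only on the first `N` edges. -/
def cylFun (N : ℕ) : Set (ChainSp G → ℂ) :=
  {F | ∀ c c' : ChainSp G, (∀ i < N, c.1 i = c'.1 i) → F c = F c'}

/-- The ray of initial vertices of a chain of edges. -/
def toRay (c : ChainSp G) : Ray G :=
  ⟨fun n => ini (c.1 n), by
    refine ⟨fun n => ?_, fun n => ?_⟩
    · have h1 : ter (c.1 n) = ini (c.1 (n + 1)) := (c.2 n).1
      have h2 : G.Adj (ini (c.1 n)) (ter (c.1 n)) := (c.1 n).2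
      rwa [h1] at h2
    · have h1 : ter (c.1 (n + 1)) = ini (c.1 (n + 2)) := (c.2 (n + 1)).1
      have h2 : ter (c.1 (n + 1)) ≠ ini (c.1 n) := (c.2 n).2
      rwa [h1] at h2⟩

/-- The endpoint map `B : 𝔓 → Ω`. -/
def endB (c : ChainSp G) : Boundary G := Quot.mk (RayRel G) (toRay G c)

/-- The pushforward `B_⋆` by fiber summation. -/
noncomputable def push (f : ChainSp G → ℂ) (ω : Boundary G) : ℂ :=
  ∑ᶠ c ∈ {c : ChainSp G | endB G c = ω}, f c

/-- The space of locally constant compactly supported functions on the shift space. -/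
noncomputable def CcP : Submodule ℂ (ChainSp G → ℂ) where
  carrier := {F | IsLocallyConstant F ∧ HasCompactSupport F}
  add_mem' hf hg := ⟨hf.1.comp₂ hg.1 (· + ·), hf.2.add hg.2⟩
  zero_mem' := ⟨IsLocallyConstant.const 0, HasCompactSupport.zero⟩
  smul_mem' c f hf := ⟨hf.1.comp (c * ·),
    hf.2.mono fun x hx h0 => hx (by simp [h0])⟩

/-- `D'(𝔓)`: the algebraic dual of `C^lc_c(𝔓)`. -/
abbrev DualP := Module.Dual ℂ ↥(CcP G)

/-- Pairing of a functional on `C^lc_c(𝔓)` with a function on the shift space. -/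
noncomputable def pairP (lam : DualP G) (g : ChainSp G → ℂ) : ℂ :=
  if h : g ∈ CcP G then lam ⟨g, h⟩ else 0

/-- The space of locally constant functions on the shift space (for finite graphs this is
`C^lc_c(𝔓)` since `𝔓` is compact). -/
noncomputable def ClcP : Submodule ℂ (ChainSp G → ℂ) where
  carrier := {F | IsLocallyConstant F}
  add_mem' hf hg := hf.comp₂ hg (· + ·)
  zero_mem' := IsLocallyConstant.const 0
  smul_mem' c f hf := hf.comp (c * ·)

/-- The dual of `C^lc(𝔓)`. -/
abbrev DualPc := Module.Dual ℂ ↥(ClcP G)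

/-- Pairing of a functional on `C^lc(𝔓)` with a function on the shift space. -/
noncomputable def pairPc (lam : DualPc G) (g : ChainSp G → ℂ) : ℂ :=
  if h : IsLocallyConstant g then lam ⟨g, h⟩ else 0

/-! ## Vertex Laplacian -/

/-- The vertex Laplacian (averaging over neighbors). -/
noncomputable def vertexLap (f : X → ℂ) (x : X) : ℂ :=
  ((deg G x : ℂ))⁻¹ * ∑ᶠ e ∈ {e : DE G | ini e = x}, f (ter e)

/-- The function `χ(z)(x) = (z + q_x z⁻¹)/(q_x + 1)`. -/
noncomputable def chi (z : ℂ) (x : X) : ℂ :=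
  (z + ((deg G x : ℂ) - 1) * z⁻¹) / (deg G x : ℂ)

/-- The `χ(z)`-eigenspace of the vertex Laplacian. -/
def vertexEig (z : ℂ) : Set (X → ℂ) := {f | ∀ x, vertexLap G f x = chi G z x * f x}

/-! ## Miscellaneous -/

/-- Two subsets of complex vector spaces (in practice: subspaces) are linearly isomorphic. -/
def AreLinIso {M N : Type} [AddCommMonoid M] [Module ℂ M] [AddCommMonoid N] [Module ℂ N]
    (A : Set M) (B : Set N) : Prop :=
  ∃ F : M → N, Set.BijOn F A B ∧ (∀ a ∈ A, ∀ b ∈ A, F (a + b) = F a + F b) ∧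
    ∀ (c : ℂ), ∀ a ∈ A, F (c • a) = c • F a

/-- The `z`-eigenspace of the edge Laplacian as a submodule (for a locally finite graph). -/
noncomputable def edgeEigSub (hlf : LocFin G) (z : ℂ) : Submodule ℂ (DE G → ℂ) where
  carrier := edgeEig G z
  add_mem' := by
    intro f g hf hg e
    have hS : {e' : DE G | ini e' = ter e ∧ e' ≠ op e}.Finite :=
      (hlf (ter e)).subset fun _ h => h.1
    have : edgeLap G (f + g) e = edgeLap G f e + edgeLap G g e := by
      simpa [edgeLap] using finsum_mem_add_distrib (f := f) (g := g) hS
    rw [this, hf e, hg e, Pi.add_apply, mul_add]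
  zero_mem' := by
    intro e
    simp [edgeLap]
  smul_mem' := by
    intro c f hf e
    have hS : {e' : DE G | ini e' = ter e ∧ e' ≠ op e}.Finite :=
      (hlf (ter e)).subset fun _ h => h.1
    have : edgeLap G (c • f) e = c * edgeLap G f e := by
      simp only [edgeLap, Pi.smul_apply, smul_eq_mul]
      rw [finsum_mem_eq_finite_toFinset_sum _ hS, finsum_mem_eq_finite_toFinset_sum _ hS,
        Finset.mul_sum]
    rw [Pi.smul_apply, smul_eq_mul, this, hf e]; ring

/-- The cyclomatic number of a finite graph, as an integer. -/
noncomputable def cyclo : ℤ := (Nat.card G.edgeSet : ℤ) - (Nat.card X : ℤ) + 1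

/-- 2-colorability. -/
def TwoColorable : Prop := ∃ col : X → Bool, ∀ x y : X, G.Adj x y → col x ≠ col y


section Tree

variable {G}

/-! ### Rays in a tree -/

theorem pred_unique (hT : G.IsTree) {a x y y' : X} (h : G.Adj y x) (h' : G.Adj y' x)
    (hd : G.dist a x = G.dist a y + 1) (hd' : G.dist a x = G.dist a y' + 1) : y = y' := by
  obtain ⟨p, hp⟩ := hT.connected.exists_walk_length_eq_dist a y
  obtain ⟨q, hq⟩ := hT.connected.exists_walk_length_eq_dist a y'
  have hpp : (p.concat h).IsPath :=
    SimpleGraph.Walk.isPath_of_length_eq_dist _ (by simp [hp, hd])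
  have hqp : (q.concat h').IsPath :=
    SimpleGraph.Walk.isPath_of_length_eq_dist _ (by simp [hq, hd'])
  have := congrArg SimpleGraph.Walk.penultimate
    ((hT.existsUnique_path a x).unique hpp hqp)
  simpa using this

theorem dist_succ_of_nonbacktracking (hT : G.IsTree) {a x y w : X} (h : G.Adj x y)
    (h' : G.Adj y w) (hw : w ≠ x) (hd : G.dist a y = G.dist a x + 1) :
    G.dist a w = G.dist a y + 1 := by
  rcases hT.dist_eq_dist_add_one_of_adj a h' with h1 | h1
  · exact absurd (pred_unique hT h'.symm h h1 hd) hw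
  · exact h1

theorem IsRay.shift {r : ℕ → X} (hr : IsRay G r) (k : ℕ) : IsRay G fun n => r (k + n) :=
  ⟨fun n => hr.1 (k + n), fun n => hr.2 (k + n)⟩

theorem IsRay.dist_zero (hT : G.IsTree) {r : ℕ → X} (hr : IsRay G r) (n : ℕ) :
    G.dist (r 0) (r n) = n := by
  have key : ∀ n, G.dist (r 0) (r n) = n ∧ G.dist (r 0) (r (n + 1)) = n + 1 := by
    intro n
    induction n with
    | zero => exact ⟨by simp, by simpa using hr.1 0⟩
    | succ n ih =>
      refine ⟨ih.2, ?_⟩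
      rw [dist_succ_of_nonbacktracking hT (hr.1 n) (hr.1 (n + 1)) (hr.2 n) (by omega), ih.2]
  exact (key n).1

theorem IsRay.injective (hT : G.IsTree) {r : ℕ → X} (hr : IsRay G r) : Injective r := by
  intro m n h
  rw [← hr.dist_zero hT m, h, hr.dist_zero hT n]

/-- Prepending a vertex to a ray. -/
def consSeq (x : X) (r : ℕ → X) : ℕ → X
  | 0 => x
  | n + 1 => r n

theorem IsRay.cons {r : ℕ → X} (hr : IsRay G r) {x : X} (hx : G.Adj x (r 0)) (h1 : r 1 ≠ x) :
    IsRay G (consSeq x r) := by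
  constructor
  · rintro (_ | n)
    · exact hx
    · exact hr.1 n
  · rintro (_ | n)
    · exact h1
    · exact hr.2 n

theorem rayRel_shift (hT : G.IsTree) (r : Ray G) (k : ℕ) :
    RayRel G r ⟨fun n => r.1 (k + n), r.2.shift k⟩ := by
  have hi : Injective fun n => r.1 (k + n) := (r.2.shift k).injective hT
  refine (infinite_range_of_injective hi).mono ?_
  rintro _ ⟨n, rfl⟩
  exact ⟨⟨k + n, rfl⟩, ⟨n, rfl⟩⟩

theorem rayRel_cons (hT : G.IsTree) (r : Ray G) {x : X} (hx : G.Adj x (r.1 0)) (h1 : r.1 1 ≠ x) :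
    RayRel G r ⟨consSeq x r.1, r.2.cons hx h1⟩ := by
  refine (infinite_range_of_injective (r.2.injective hT)).mono ?_
  rintro _ ⟨n, rfl⟩
  exact ⟨⟨n, rfl⟩, ⟨n + 1, rfl⟩⟩

theorem exists_ray_of_adj (hT : G.IsTree) {x y : X} (h : G.Adj y x) {ω : Boundary G}
    (hx : ∃ r : Ray G, Quot.mk (RayRel G) r = ω ∧ r.1 0 = x) :
    ∃ r : Ray G, Quot.mk (RayRel G) r = ω ∧ r.1 0 = y := by
  obtain ⟨r, rfl, rfl⟩ := hx
  by_cases h1 : r.1 1 = y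
  · exact ⟨_, (Quot.sound (rayRel_shift hT r 1)).symm, h1⟩
  · exact ⟨_, (Quot.sound (rayRel_cons hT r h h1)).symm, rfl⟩

theorem exists_ray_from (hT : G.IsTree) (x : X) (ω : Boundary G) :
    ∃ r : Ray G, Quot.mk (RayRel G) r = ω ∧ r.1 0 = x := by
  obtain ⟨r, rfl⟩ := Quot.exists_rep ω
  obtain ⟨p⟩ := hT.connected x (r.1 0)
  generalize hy : r.1 0 = y at p
  induction p with
  | nil => exact ⟨r, rfl, hy⟩
  | cons h p ih => exact exists_ray_of_adj hT h (ih hy)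

/-! ### The horocycle bracket -/

theorem exists_busemann (hT : G.IsTree) (x y : X) (r : Ray G) :
    ∃ k : ℤ, ∀ᶠ n in Filter.atTop, (G.dist x (r.1 n) : ℤ) - G.dist y (r.1 n) = k := by
  have aux : ∀ x : X, ∃ k : ℤ, ∀ᶠ n in Filter.atTop, (G.dist x (r.1 n) : ℤ) - n = k := by
    intro x
    set c : ℕ → ℕ := fun n => G.dist x (r.1 n) + G.dist x (r.1 0) - n with hc
    have hle : ∀ n, n ≤ G.dist x (r.1 n) + G.dist x (r.1 0) := by
      intro n
      have h1 := r.2.dist_zero hT n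
      have h2 := hT.connected.dist_triangle (u := r.1 0) (v := x) (w := r.1 n)
      rw [SimpleGraph.dist_comm (u := r.1 0) (v := x)] at h2
      omega
    have hanti : Antitone c := by
      refine antitone_nat_of_succ_le fun n => ?_
      have h1 := hT.connected.dist_triangle (u := x) (v := r.1 n) (w := r.1 (n + 1))
      have h2 : G.dist (r.1 n) (r.1 (n + 1)) = 1 := by simpa using r.2.1 n
      have h3 := hle n
      simp only [hc]
      omega
    refine ⟨(c (argmin c) : ℤ) - G.dist x (r.1 0), ?_⟩
    filter_upwards [Filter.eventually_ge_atTop (argmin c)] with n hn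
    have h1 : c n = c (argmin c) := le_antisymm (hanti hn) (argmin_le c n)
    have h3 := hle n
    rw [← h1]
    simp only [hc]
    omega
  obtain ⟨k, hk⟩ := aux x
  obtain ⟨l, hl⟩ := aux y
  refine ⟨k - l, ?_⟩
  filter_upwards [hk, hl] with n h1 h2
  omega

theorem exists_common {r r' : Ray G} (h : RayRel G r r') {P Q : X → Prop}
    (hP : ∀ᶠ n in Filter.atTop, P (r.1 n)) (hQ : ∀ᶠ n in Filter.atTop, Q (r'.1 n)) :
    ∃ v, P v ∧ Q v := by
  obtain ⟨N, hN⟩ := Filter.eventually_atTop.1 hP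
  obtain ⟨M, hM⟩ := Filter.eventually_atTop.1 hQ
  have hfin : (r.1 '' Iio N ∪ r'.1 '' Iio M).Finite :=
    ((finite_Iio N).image _).union ((finite_Iio M).image _)
  obtain ⟨v, ⟨⟨n, hn⟩, ⟨m, hm⟩⟩, hv⟩ := (Set.Infinite.sdiff h hfin).nonempty
  refine ⟨v, ?_, ?_⟩
  · rw [← hn]
    exact hN n (not_lt.1 fun hlt => hv (Or.inl ⟨n, hlt, hn⟩))
  · rw [← hm]
    exact hM m (not_lt.1 fun hlt => hv (Or.inr ⟨m, hlt, hm⟩))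

theorem busemann_of_rayRel (hT : G.IsTree) {x y : X} {k : ℤ} {r r' : Ray G} (h : RayRel G r r') :
    (∀ᶠ n in Filter.atTop, (G.dist x (r.1 n) : ℤ) - G.dist y (r.1 n) = k) ↔
      ∀ᶠ n in Filter.atTop, (G.dist x (r'.1 n) : ℤ) - G.dist y (r'.1 n) = k := by
  obtain ⟨l, hl⟩ := exists_busemann hT x y r
  obtain ⟨l', hl'⟩ := exists_busemann hT x y r'
  obtain ⟨v, hv, hv'⟩ := exists_common h (P := fun v => (G.dist x v : ℤ) - G.dist y v = l)
    (Q := fun v => (G.dist x v : ℤ) - G.dist y v = l') hl hl'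
  have hll : l = l' := hv.symm.trans hv'
  constructor
  · intro hk
    obtain ⟨n, h1, h2⟩ := (hk.and hl).exists
    filter_upwards [hl'] with m hm
    omega
  · intro hk
    obtain ⟨n, h1, h2⟩ := (hk.and hl').exists
    filter_upwards [hl] with m hm
    omega

theorem busemann_of_mk_eq (hT : G.IsTree) {x y : X} {k : ℤ} {r r' : Ray G}
    (h : Quot.mk (RayRel G) r = Quot.mk (RayRel G) r')
    (hk : ∀ᶠ n in Filter.atTop, (G.dist x (r.1 n) : ℤ) - G.dist y (r.1 n) = k) :
    ∀ᶠ n in Filter.atTop, (G.dist x (r'.1 n) : ℤ) - G.dist y (r'.1 n) = k := by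
  let P : Boundary G → Prop := Quot.lift
    (fun r : Ray G => ∀ᶠ n in Filter.atTop, (G.dist x (r.1 n) : ℤ) - G.dist y (r.1 n) = k)
    fun r r' h => propext (busemann_of_rayRel hT h)
  have h1 : P (Quot.mk _ r) := hk
  rw [h] at h1
  exact h1

theorem horo_spec (hT : G.IsTree) (o x : X) (r : Ray G) :
    ∀ᶠ n in Filter.atTop,
      (G.dist o (r.1 n) : ℤ) - G.dist x (r.1 n) = horo G o x (Quot.mk (RayRel G) r) := by
  have hex : ∃ k : ℤ, ∀ s : Ray G, Quot.mk (RayRel G) s = Quot.mk (RayRel G) r → s.1 0 = o →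
      ∃ N : ℕ, ∀ n : ℕ, N ≤ n → (G.dist x (s.1 n) : ℤ) = (n : ℤ) - k := by
    obtain ⟨k, hk⟩ := exists_busemann hT o x r
    refine ⟨k, fun s hs hs0 => Filter.eventually_atTop.1 ?_⟩
    filter_upwards [busemann_of_mk_eq hT hs.symm hk] with n hn
    have := s.2.dist_zero hT n
    rw [hs0] at this
    omega
  obtain ⟨s, hs, hs0⟩ := exists_ray_from hT o (Quot.mk (RayRel G) r)
  refine busemann_of_mk_eq hT hs ?_
  have hh : horo G o x (Quot.mk (RayRel G) r) = hex.choose := dif_pos hex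
  rw [hh]
  filter_upwards [Filter.eventually_atTop.2 (hex.choose_spec s hs hs0)] with n hn
  have := s.2.dist_zero hT n
  rw [hs0] at this
  omega

theorem horo_self (hT : G.IsTree) (o : X) (ω : Boundary G) : horo G o o ω = 0 := by
  obtain ⟨r, rfl⟩ := Quot.exists_rep ω
  obtain ⟨n, hn⟩ := (horo_spec hT o o r).exists
  rw [← hn, sub_self]

theorem horo_ter (hT : G.IsTree) (o : X) {e : DE G} {ω : Boundary G} (h : ω ∈ plusBd G e) :
    horo G o (ter e) ω = horo G o (ini e) ω + 1 := by
  obtain ⟨r, rfl, h0, h1⟩ := h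
  obtain ⟨n, ⟨hn, hn'⟩, hpos⟩ := (((horo_spec hT o (ini e) r).and (horo_spec hT o (ter e) r)).and
    (Filter.eventually_ge_atTop 1)).exists
  have h2 := r.2.dist_zero hT n
  have h3 := (r.2.shift 1).dist_zero hT (n - 1)
  rw [show 1 + (n - 1) = n by omega] at h3
  simp only [add_zero] at h3
  rw [h0] at h2
  rw [h1] at h3
  omega

/-! ### The sets of boundary points seen by an edge -/

@[simp] theorem ini_op (e : DE G) : ini (op e) = ter e := rfl

@[simp] theorem ter_op (e : DE G) : ter (op e) = ini e := rfl

@[simp] theorem op_op (e : DE G) : op (op e) = e := rfl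

theorem DE.ext {e e' : DE G} (h : ini e = ini e') (h' : ter e = ter e') : e = e' :=
  Subtype.ext (Prod.ext h h')

theorem adj_ini_ter (e : DE G) : G.Adj (ini e) (ter e) := e.2

/-- The set of directed edges that may follow `e` in a non-backtracking chain. -/
def succs (e : DE G) : Set (DE G) := {e' | ini e' = ter e ∧ e' ≠ op e}

theorem succs_finite (hlf : LocFin G) (e : DE G) : (succs e).Finite :=
  (hlf (ter e)).subset fun _ h => h.1

theorem ter_ne_of_mem_succs {e e' : DE G} (h : e' ∈ succs e) : ter e' ≠ ini e :=
  fun h' => h.2 (DE.ext h.1 h')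

theorem plusBd_op_disjoint (hT : G.IsTree) {e : DE G} {ω : Boundary G} (h : ω ∈ plusBd G e) :
    ω ∉ plusBd G (op e) := by
  intro h'
  have h1 := horo_ter hT (ini e) h
  have h2 := horo_ter hT (ini e) h'
  simp only [ini_op, ter_op] at h2
  omega

theorem plusBd_succ_subset (hT : G.IsTree) {e e' : DE G} (h : e' ∈ succs e) :
    plusBd G e' ⊆ plusBd G e := by
  rintro _ ⟨r, rfl, h0, h1⟩
  have ha : G.Adj (ini e) (r.1 0) := by rw [h0, h.1]; exact adj_ini_ter e
  have hne : r.1 1 ≠ ini e := by rw [h1]; exact ter_ne_of_mem_succs h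
  exact ⟨_, (Quot.sound (rayRel_cons hT r ha hne)).symm, rfl, h0.trans h.1⟩

theorem plusBd_unique (hT : G.IsTree) {e e' : DE G} {ω : Boundary G} (hi : ini e = ini e')
    (h : ω ∈ plusBd G e) (h' : ω ∈ plusBd G e') : e = e' := by
  by_contra hne
  exact plusBd_op_disjoint hT h'
    (plusBd_succ_subset hT (e := op e') (e' := e) ⟨hi, by simpa using hne⟩ h)

theorem exists_plusBd (hT : G.IsTree) (x : X) (ω : Boundary G) :
    ∃ e : DE G, ini e = x ∧ ω ∈ plusBd G e := by
  obtain ⟨r, hr, h0⟩ := exists_ray_from hT x ω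
  exact ⟨⟨(r.1 0, r.1 1), r.2.1 0⟩, h0, r, hr, rfl, rfl⟩

theorem exists_succ_plusBd (hT : G.IsTree) {e : DE G} {ω : Boundary G} (h : ω ∈ plusBd G e) :
    ∃ e' ∈ succs e, ω ∈ plusBd G e' := by
  obtain ⟨e', hi, hω⟩ := exists_plusBd hT (ter e) ω
  exact ⟨e', ⟨hi, fun heq => plusBd_op_disjoint hT h (heq ▸ hω)⟩, hω⟩

theorem mem_plusBd_op (hT : G.IsTree) {e : DE G} {ω : Boundary G} :
    ω ∈ plusBd G (op e) ↔ ω ∉ plusBd G e := by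
  refine ⟨fun h h' => plusBd_op_disjoint hT h' h, fun h => ?_⟩
  obtain ⟨e', hi, hω⟩ := exists_plusBd hT (ini e) ω
  exact plusBd_succ_subset hT (e := op e) ⟨hi, fun heq => h (by simpa [heq] using hω)⟩ hω

theorem exists_succ (hnd : ∀ x : X, 2 ≤ deg G x) (e : DE G) :
    ∃ e', e' ∈ succs e := by
  obtain ⟨e', h1, h2⟩ := Set.exists_ne_of_one_lt_ncard
    (s := {e' : DE G | ini e' = ter e}) (hnd (ter e)) (op e)
  exact ⟨e', h1, h2⟩

theorem exists_mem_plusBd_of_chain (hT : G.IsTree) {c : ℕ → DE G}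
    (hc : ∀ n, c (n + 1) ∈ succs (c n)) : ∃ ω : Boundary G, ∀ n, ω ∈ plusBd G (c n) := by
  let r : Ray G := toRay G ⟨c, fun n => ⟨(hc n).1.symm, ter_ne_of_mem_succs (hc n)⟩⟩
  exact ⟨_, fun n => ⟨_, (Quot.sound (rayRel_shift hT r n)).symm, rfl, (hc n).1⟩⟩

theorem plusBd_nonempty (hT : G.IsTree) (hnd : ∀ x : X, 2 ≤ deg G x) (e : DE G) :
    (plusBd G e).Nonempty := by
  choose s hs using exists_succ hnd
  obtain ⟨ω, hω⟩ := exists_mem_plusBd_of_chain hT (c := fun n => s^[n] e) fun n => by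
    rw [iterate_succ_apply']
    exact hs _
  exact ⟨ω, hω 0⟩

/-! ### Edges pointing away from the base point, by level -/

/-- The edges pointing away from `o` whose initial point has distance `n` to `o`. -/
def lvl (o : X) (n : ℕ) : Set (DE G) := {e | G.dist o (ini e) = n ∧ G.dist o (ter e) = n + 1}

theorem mem_lvl_or (hT : G.IsTree) (o : X) (e : DE G) :
    ∃ n, e ∈ lvl o n ∨ op e ∈ lvl o n := by
  rcases hT.dist_eq_dist_add_one_of_adj o (adj_ini_ter e) with h | h
  · exact ⟨_, Or.inr ⟨rfl, h⟩⟩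
  · exact ⟨_, Or.inl ⟨rfl, h⟩⟩

theorem succ_mem_lvl (hT : G.IsTree) {o : X} {n : ℕ} {e e' : DE G} (he : e ∈ lvl o n)
    (h : e' ∈ succs e) : e' ∈ lvl o (n + 1) := by
  have h1 : G.dist o (ini e') = n + 1 := by rw [h.1]; exact he.2
  refine ⟨h1, ?_⟩
  have ha : G.Adj (ini e) (ini e') := by rw [h.1]; exact adj_ini_ter e
  rw [dist_succ_of_nonbacktracking hT ha (adj_ini_ter e') (ter_ne_of_mem_succs h)
    (by rw [h1, he.1]), h1]

theorem exists_pred_lvl (hT : G.IsTree) {o : X} {n : ℕ} {e' : DE G} (he : e' ∈ lvl o (n + 1)) :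
    ∃ e ∈ lvl o n, e' ∈ succs e := by
  obtain ⟨p, hp⟩ := hT.connected.exists_walk_length_eq_dist (ini e') o
  rw [SimpleGraph.dist_comm, he.1] at hp
  have : ∃ u, G.Adj u (ini e') ∧ G.dist o u ≤ n := by
    cases p with
    | nil => simp at hp
    | cons h p =>
      refine ⟨_, h.symm, ?_⟩
      rw [SimpleGraph.dist_comm]
      refine (SimpleGraph.dist_le p).trans ?_
      simpa using hp.le
  obtain ⟨u, hu, hd⟩ := this
  have h1 := he.1
  have h2 := he.2
  have h3 : G.dist o u = n := by
    rcases hT.dist_eq_dist_add_one_of_adj o hu with h | h <;> omega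
  refine ⟨⟨(u, ini e'), hu⟩, ⟨h3, h1⟩, rfl, fun heq => ?_⟩
  have h4 : ter e' = u := congrArg ter heq
  rw [h4] at h2
  omega

theorem lvl_unique (hT : G.IsTree) {o : X} {n : ℕ} {e e' : DE G} {ω : Boundary G}
    (he : e ∈ lvl o n) (he' : e' ∈ lvl o n) (h : ω ∈ plusBd G e) (h' : ω ∈ plusBd G e') :
    e = e' := by
  refine plusBd_unique hT ?_ h h'
  induction n generalizing e e' with
  | zero =>
    rw [← (hT.connected.dist_eq_zero_iff).1 he.1, ← (hT.connected.dist_eq_zero_iff).1 he'.1]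
  | succ n ih =>
    obtain ⟨d, hd, hs⟩ := exists_pred_lvl hT he
    obtain ⟨d', hd', hs'⟩ := exists_pred_lvl hT he'
    have hω := plusBd_succ_subset hT hs h
    have hω' := plusBd_succ_subset hT hs' h'
    rw [hs.1, hs'.1, plusBd_unique hT (ih hd hd' hω hω') hω hω']

theorem exists_lvl (hT : G.IsTree) (o : X) (n : ℕ) (ω : Boundary G) :
    ∃ e ∈ lvl o n, ω ∈ plusBd G e := by
  induction n with
  | zero =>
    obtain ⟨e, he, hω⟩ := exists_plusBd hT o ω
    refine ⟨e, ⟨by simp [he], ?_⟩, hω⟩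
    rw [← he]
    simpa using adj_ini_ter e
  | succ n ih =>
    obtain ⟨e, he, hω⟩ := ih
    obtain ⟨e', hs, hω'⟩ := exists_succ_plusBd hT hω
    exact ⟨e', succ_mem_lvl hT he hs, hω'⟩

theorem lvl_nested (hT : G.IsTree) {o : X} {n m : ℕ} (hnm : n ≤ m) {e e' : DE G} {ω : Boundary G}
    (he : e ∈ lvl o n) (he' : e' ∈ lvl o m) (h : ω ∈ plusBd G e) (h' : ω ∈ plusBd G e') :
    plusBd G e' ⊆ plusBd G e := by
  induction m, hnm using Nat.le_induction generalizing e' with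
  | base => rw [lvl_unique hT he he' h h']
  | succ m hm ih =>
    obtain ⟨d, hd, hs⟩ := exists_pred_lvl hT he'
    have hsub := plusBd_succ_subset hT hs
    exact hsub.trans (ih hd (hsub h'))

theorem lvl_succ_eq (hT : G.IsTree) (o : X) (n : ℕ) :
    (lvl o (n + 1) : Set (DE G)) = ⋃ e ∈ lvl o n, succs e := by
  ext e'
  simp only [mem_iUnion, exists_prop]
  exact ⟨exists_pred_lvl hT, fun ⟨e, he, hs⟩ => succ_mem_lvl hT he hs⟩

theorem lvl_finite (hT : G.IsTree) (hlf : LocFin G) (o : X) (n : ℕ) :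
    (lvl o n : Set (DE G)).Finite := by
  induction n with
  | zero => exact (hlf o).subset fun e he => ((hT.connected.dist_eq_zero_iff).1 he.1).symm
  | succ n ih =>
    rw [lvl_succ_eq hT]
    exact ih.biUnion fun e _ => succs_finite hlf e

theorem edge_induction (hT : G.IsTree) (o : X) {P : DE G → Prop} (haway : ∀ n, ∀ e ∈ lvl o n, P e)
    (hsucc : ∀ e, (∀ e' ∈ succs e, P e') → P e) (e : DE G) : P e := by
  have key : ∀ n, ∀ e : DE G, op e ∈ lvl o n → P e := by
    intro n
    induction n using Nat.strong_induction_on with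
    | _ n ih =>
      intro e he
      refine hsucc e fun e' hs => ?_
      have h1 : G.dist o (ini e') = n := by rw [hs.1]; exact he.1
      rcases hT.dist_eq_dist_add_one_of_adj o (adj_ini_ter e') with h | h
      · exact ih (G.dist o (ter e')) (by omega) e' ⟨rfl, h⟩
      · exact haway n e' ⟨h1, by rw [h, h1]⟩
  obtain ⟨n, h | h⟩ := mem_lvl_or hT o e
  exacts [haway n e h, key n e h]

theorem sum_indicator_succs (hT : G.IsTree) (hlf : LocFin G) (e : DE G) (g : Boundary G → ℂ) :
    ∑ e' ∈ (succs_finite hlf e).toFinset, (plusBd G e').indicator g = (plusBd G e).indicator g := by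
  have hU : plusBd G e = ⋃ e' ∈ (succs_finite hlf e).toFinset, plusBd G e' := by
    ext ω
    simp only [mem_iUnion, Set.Finite.mem_toFinset, exists_prop]
    exact ⟨exists_succ_plusBd hT, fun ⟨e', hs, h⟩ => plusBd_succ_subset hT hs h⟩
  rw [hU, Finset.indicator_biUnion]
  · ext ω
    simp
  · intro d hd d' hd' hne
    rw [Finset.mem_coe, Set.Finite.mem_toFinset] at hd hd'
    exact Set.disjoint_left.2 fun ω h h' => hne (plusBd_unique hT (hd.1.trans hd'.1.symm) h h')

theorem sum_indicator_lvl (hT : G.IsTree) (hlf : LocFin G) (o : X) (n : ℕ) (g : Boundary G → ℂ) :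
    ∑ e ∈ (lvl_finite hT hlf o n).toFinset, (plusBd G e).indicator g = g := by
  have hU : (univ : Set (Boundary G)) = ⋃ e ∈ (lvl_finite hT hlf o n).toFinset, plusBd G e := by
    ext ω
    simpa using exists_lvl hT o n ω
  conv_rhs => rw [← indicator_univ g, hU]
  rw [Finset.indicator_biUnion]
  · ext ω
    simp
  · intro d hd d' hd' hne
    rw [Finset.mem_coe, Set.Finite.mem_toFinset] at hd hd'
    exact Set.disjoint_left.2 fun ω h h' => hne (lvl_unique hT hd hd' h h')

/-! ### Locally constant functions on the boundary -/

/-- Functions on the boundary that are constant on `∂₊ e` for all edges `e` of level `n`. -/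
def IsLvlConst (o : X) (n : ℕ) (g : Boundary G → ℂ) : Prop :=
  ∀ e ∈ lvl o n, ∀ ω ∈ plusBd G e, ∀ ω' ∈ plusBd G e, g ω = g ω'

theorem IsLvlConst.mono (hT : G.IsTree) {o : X} {n m : ℕ} (hnm : n ≤ m) {g : Boundary G → ℂ}
    (hg : IsLvlConst o n g) : IsLvlConst o m g := by
  intro e he ω h ω' h'
  obtain ⟨d, hd, hω⟩ := exists_lvl hT o n ω
  exact hg d hd ω hω ω' (lvl_nested hT hnm hd he hω h h')

theorem isLvlConst_indicator (hT : G.IsTree) {o : X} {n : ℕ} {e : DE G} (he : e ∈ lvl o n)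
    {g : Boundary G → ℂ} (hg : ∀ ω ∈ plusBd G e, ∀ ω' ∈ plusBd G e, g ω = g ω') :
    IsLvlConst o n ((plusBd G e).indicator g) := by
  intro d hd ω h ω' h'
  by_cases hde : d = e
  · subst hde
    rw [indicator_of_mem h, indicator_of_mem h', hg ω h ω' h']
  · rw [indicator_of_notMem fun hω => hde (lvl_unique hT hd he h hω),
      indicator_of_notMem fun hω => hde (lvl_unique hT hd he h' hω)]

theorem isOpen_plusBd (e : DE G) : IsOpen (plusBd G e) :=
  TopologicalSpace.isOpen_generateFrom_of_mem ⟨e, rfl⟩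

theorem IsLvlConst.isLocallyConstant (hT : G.IsTree) {o : X} {n : ℕ} {g : Boundary G → ℂ}
    (hg : IsLvlConst o n g) : IsLocallyConstant g := by
  rw [IsLocallyConstant.iff_exists_open]
  intro ω
  obtain ⟨e, he, hω⟩ := exists_lvl hT o n ω
  exact ⟨_, isOpen_plusBd e, hω, fun ω' h' => hg e he ω' h' ω hω⟩

theorem exists_lvl_subset_of_isOpen (hT : G.IsTree) (o : X) {U : Set (Boundary G)} (hU : IsOpen U)
    {ω : Boundary G} (hω : ω ∈ U) : ∃ n, ∃ e ∈ lvl o n, ω ∈ plusBd G e ∧ plusBd G e ⊆ U := by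
  induction hU with
  | basic s hs =>
    obtain ⟨d, rfl⟩ := hs
    obtain ⟨n, h | h⟩ := mem_lvl_or hT o d
    · exact ⟨n, d, h, hω, Subset.rfl⟩
    · obtain ⟨e, he, h'⟩ := exists_lvl hT o n ω
      refine ⟨n, e, he, h', fun ω' hω' => ?_⟩
      by_contra hn
      have heq := lvl_unique hT he h hω' ((mem_plusBd_op hT).2 hn)
      exact plusBd_op_disjoint hT hω (heq ▸ h')
  | univ =>
    obtain ⟨e, he, h⟩ := exists_lvl hT o 0 ω
    exact ⟨0, e, he, h, subset_univ _⟩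
  | inter s t _ _ ihs iht =>
    obtain ⟨n, e, he, h, hs⟩ := ihs hω.1
    obtain ⟨m, d, hd, h', ht⟩ := iht hω.2
    rcases le_total n m with hnm | hnm
    · exact ⟨m, d, hd, h', subset_inter ((lvl_nested hT hnm he hd h h').trans hs) ht⟩
    · exact ⟨n, e, he, h, subset_inter hs ((lvl_nested hT hnm hd he h' h).trans ht)⟩
  | sUnion S _ ih =>
    obtain ⟨s, hs, hωs⟩ := hω
    obtain ⟨n, e, he, h, hsub⟩ := ih s hs hωs
    exact ⟨n, e, he, h, hsub.trans (subset_sUnion_of_mem hs)⟩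

/-- The space of functions on the boundary that are constant on all `∂₊ e` of some level. -/
def lvlConst (hT : G.IsTree) (o : X) : Submodule ℂ (Boundary G → ℂ) where
  carrier := {g | ∃ n, IsLvlConst o n g}
  add_mem' := by
    rintro g h ⟨n, hg⟩ ⟨m, hh⟩
    refine ⟨max n m, fun e he ω hω ω' hω' => ?_⟩
    rw [Pi.add_apply, Pi.add_apply, hg.mono hT (le_max_left n m) e he ω hω ω' hω',
      hh.mono hT (le_max_right n m) e he ω hω ω' hω']
  zero_mem' := ⟨0, fun _ _ _ _ _ _ => rfl⟩
  smul_mem' := by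
    rintro c g ⟨n, hg⟩
    refine ⟨n, fun e he ω hω ω' hω' => ?_⟩
    rw [Pi.smul_apply, Pi.smul_apply, hg e he ω hω ω' hω']

theorem exists_isLvlConst (hT : G.IsTree) (hlf : LocFin G) (o : X) {g : Boundary G → ℂ}
    (hg : IsLocallyConstant g) : ∃ n, IsLvlConst o n g := by
  change g ∈ lvlConst hT o
  by_contra hbad
  have h0 : ∃ e ∈ lvl o 0, (plusBd G e).indicator g ∉ lvlConst hT o := by
    by_contra! h
    refine hbad ?_
    rw [← sum_indicator_lvl hT hlf o 0 g]
    exact Submodule.sum_mem _ fun e he => h e ((Set.Finite.mem_toFinset _).1 he)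
  have hstep : ∀ e : {e : DE G // (plusBd G e).indicator g ∉ lvlConst hT o},
      ∃ e' : {e : DE G // (plusBd G e).indicator g ∉ lvlConst hT o}, e'.1 ∈ succs e.1 := by
    rintro ⟨e, he⟩
    by_contra! h
    refine he ?_
    rw [← sum_indicator_succs hT hlf e g]
    refine Submodule.sum_mem _ fun e' he' => ?_
    by_contra hb
    exact h ⟨e', hb⟩ ((Set.Finite.mem_toFinset _).1 he')
  choose s hs using hstep
  obtain ⟨e, he, hb⟩ := h0
  set c : ℕ → DE G := fun n => (s^[n] ⟨e, hb⟩).1 with hc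
  have hcs : ∀ n, c (n + 1) ∈ succs (c n) := by
    intro n
    simp only [hc]
    rw [iterate_succ_apply']
    exact hs _
  have hcl : ∀ n, c n ∈ lvl o n := by
    intro n
    induction n with
    | zero => exact he
    | succ n ih => exact succ_mem_lvl hT ih (hcs n)
  obtain ⟨ω, hω⟩ := exists_mem_plusBd_of_chain hT hcs
  obtain ⟨U, hU, hωU, hgU⟩ := hg.exists_open ω
  obtain ⟨n, d, hd, hωd, hdU⟩ := exists_lvl_subset_of_isOpen hT o hU hωU
  have hdc : d = c n := lvl_unique hT hd (hcl n) hωd (hω n)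
  subst hdc
  exact (s^[n] ⟨e, hb⟩).2 ⟨n, isLvlConst_indicator hT hd fun ω₁ h₁ ω₂ h₂ =>
    (hgU ω₁ (hdU h₁)).trans (hgU ω₂ (hdU h₂)).symm⟩

/-! ### The edge Poisson kernel -/

/-- The kernel of the edge Poisson transform. -/
noncomputable def edgeKernel (o : X) (z : ℂ) (e : DE G) : Boundary G → ℂ :=
  fun ω => z ^ horo G o (ini e) ω * (plusBd G e).indicator 1 ω

theorem edgeKernel_eq_indicator (o : X) (z : ℂ) (e : DE G) :
    edgeKernel o z e = (plusBd G e).indicator fun ω => z ^ horo G o (ini e) ω := by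
  ext ω
  by_cases h : ω ∈ plusBd G e <;> simp [edgeKernel, h]

theorem horo_of_mem_lvl (hT : G.IsTree) {o : X} {n : ℕ} {e : DE G} (he : e ∈ lvl o n)
    {ω : Boundary G} (hω : ω ∈ plusBd G e) : horo G o (ini e) ω = n := by
  induction n generalizing e with
  | zero =>
    rw [← (hT.connected.dist_eq_zero_iff).1 he.1, horo_self hT]
    rfl
  | succ n ih =>
    obtain ⟨d, hd, hs⟩ := exists_pred_lvl hT he
    have hωd := plusBd_succ_subset hT hs hω
    rw [hs.1, horo_ter hT o hωd, ih hd hωd]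
    push_cast
    rfl

theorem edgeKernel_of_mem_lvl (hT : G.IsTree) {o : X} (z : ℂ) {n : ℕ} {e : DE G}
    (he : e ∈ lvl o n) : edgeKernel o z e = (plusBd G e).indicator fun _ => z ^ n := by
  rw [edgeKernel_eq_indicator]
  refine indicator_congr fun ω hω => ?_
  rw [horo_of_mem_lvl hT he hω, zpow_natCast]

theorem sum_edgeKernel (hT : G.IsTree) (hlf : LocFin G) (o : X) {z : ℂ} (hz : z ≠ 0) (e : DE G) :
    ∑ e' ∈ (succs_finite hlf e).toFinset, edgeKernel o z e' = z • edgeKernel o z e := by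
  have h1 : ∀ e' ∈ (succs_finite hlf e).toFinset, edgeKernel o z e' =
      (plusBd G e').indicator fun ω => z ^ horo G o (ter e) ω := by
    intro e' he'
    rw [edgeKernel_eq_indicator, ((Set.Finite.mem_toFinset _).1 he').1]
  rw [Finset.sum_congr rfl h1, sum_indicator_succs hT hlf, edgeKernel_eq_indicator]
  ext ω
  by_cases h : ω ∈ plusBd G e
  · simp [h, horo_ter hT o h, zpow_add₀ hz, mul_comm]
  · simp [h]

theorem edgeKernel_mem_Clc (hT : G.IsTree) (hlf : LocFin G) (o : X) {z : ℂ} (hz : z ≠ 0)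
    (e : DE G) : edgeKernel o z e ∈ Clc G := by
  refine edge_induction hT o (P := fun e => edgeKernel o z e ∈ Clc G) ?_ ?_ e
  · intro n e he
    rw [edgeKernel_of_mem_lvl hT z he]
    exact (isLvlConst_indicator hT he fun _ _ _ _ => rfl).isLocallyConstant hT
  · intro e h
    have hs := Submodule.sum_mem (Clc G) (t := (succs_finite hlf e).toFinset)
      (f := edgeKernel o z) fun e' he' => h e' ((Set.Finite.mem_toFinset _).1 he')
    rw [sum_edgeKernel hT hlf o hz] at hs
    exact (Submodule.smul_mem_iff _ hz).1 hs

theorem edgePoisson_apply (hT : G.IsTree) (hlf : LocFin G) (o : X) {z : ℂ} (hz : z ≠ 0)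
    (μ : DualB G) (e : DE G) :
    edgePoisson G o z μ e = μ ⟨edgeKernel o z e, edgeKernel_mem_Clc hT hlf o hz e⟩ :=
  dif_pos (edgeKernel_mem_Clc hT hlf o hz e)

theorem edgeLap_eq_sum (hlf : LocFin G) (f : DE G → ℂ) (e : DE G) :
    edgeLap G f e = ∑ e' ∈ (succs_finite hlf e).toFinset, f e' :=
  finsum_mem_eq_finite_toFinset_sum f (succs_finite hlf e)

theorem edgePoisson_mem_edgeEig (hT : G.IsTree) (hlf : LocFin G) (o : X) {z : ℂ} (hz : z ≠ 0)
    (μ : DualB G) : edgePoisson G o z μ ∈ edgeEig G z := by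
  intro e
  rw [edgeLap_eq_sum hlf]
  simp only [edgePoisson_apply hT hlf o hz]
  rw [← map_sum, ← smul_eq_mul, ← map_smul]
  congr 1
  ext1
  simpa using sum_edgeKernel hT hlf o hz e

theorem edgePoisson_injective (hT : G.IsTree) (hlf : LocFin G) (hnd : ∀ x : X, 2 ≤ deg G x)
    (o : X) {z : ℂ} (hz : z ≠ 0) : Injective (edgePoisson G o z) := by
  intro μ ν h
  refine LinearMap.ext fun ⟨g, hg⟩ => ?_
  obtain ⟨n, hn⟩ := exists_isLvlConst hT hlf o hg
  choose b hb using plusBd_nonempty hT hnd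
  have hsum : (⟨g, hg⟩ : Clc G) = ∑ e ∈ (lvl_finite hT hlf o n).toFinset,
      (g (b e) * (z ^ n)⁻¹) • (⟨edgeKernel o z e, edgeKernel_mem_Clc hT hlf o hz e⟩ : Clc G) := by
    ext1
    simp only [AddSubmonoidClass.coe_finsetSum, Submodule.coe_smul]
    conv_lhs => rw [← sum_indicator_lvl hT hlf o n g]
    refine Finset.sum_congr rfl fun e he => ?_
    have hel := (Set.Finite.mem_toFinset _).1 he
    rw [edgeKernel_of_mem_lvl hT z hel]
    ext ω
    by_cases hω : ω ∈ plusBd G e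
    · simp [hω, hn e hel ω hω (b e) (hb e), hz]
    · simp [hω]
  rw [hsum]
  simp only [map_sum, map_smul, ← edgePoisson_apply hT hlf o hz, h]

/-! ### Surjectivity -/

theorem exists_eventual_limit {V : Type*} [AddCommGroup V] [Module ℂ V] (M : ℕ → V →ₗ[ℂ] ℂ)
    (h : ∀ v, ∃ c, ∀ᶠ n in Filter.atTop, M n v = c) :
    ∃ μ : V →ₗ[ℂ] ℂ, ∀ v, ∀ᶠ n in Filter.atTop, M n v = μ v := by
  choose c hc using h
  refine ⟨⟨⟨c, fun v w => ?_⟩, fun a v => ?_⟩, hc⟩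
  · obtain ⟨n, h1, h2, h3⟩ := ((hc (v + w)).and ((hc v).and (hc w))).exists
    rw [← h1, ← h2, ← h3, map_add]
  · obtain ⟨n, h1, h2⟩ := ((hc (a • v)).and (hc v)).exists
    simp [← h1, ← h2]

/-- The Riemann sum of `g` over the edges of level `n`, with respect to the finitely additive
measure with boundary transform `f` and the sample points `b`. -/
noncomputable def lvlSum (hT : G.IsTree) (hlf : LocFin G) (o : X) (z : ℂ) (f : DE G → ℂ)
    (b : DE G → Boundary G) (n : ℕ) : (Boundary G → ℂ) →ₗ[ℂ] ℂ :=
  ∑ e ∈ (lvl_finite hT hlf o n).toFinset, ((z ^ n)⁻¹ * f e) • LinearMap.proj (b e)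

theorem lvlSum_apply (hT : G.IsTree) (hlf : LocFin G) (o : X) (z : ℂ) (f : DE G → ℂ)
    (b : DE G → Boundary G) (n : ℕ) (g : Boundary G → ℂ) :
    lvlSum hT hlf o z f b n g =
      ∑ e ∈ (lvl_finite hT hlf o n).toFinset, (z ^ n)⁻¹ * f e * g (b e) := by
  simp [lvlSum]

theorem lvlSum_succ (hT : G.IsTree) (hlf : LocFin G) (o : X) {z : ℂ} (hz : z ≠ 0)
    {f : DE G → ℂ} (hf : f ∈ edgeEig G z) {b : DE G → Boundary G} (hb : ∀ e, b e ∈ plusBd G e)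
    {n : ℕ} {g : Boundary G → ℂ} (hg : IsLvlConst o n g) :
    lvlSum hT hlf o z f b (n + 1) g = lvlSum hT hlf o z f b n g := by
  have hU : (lvl_finite hT hlf o (n + 1)).toFinset =
      (lvl_finite hT hlf o n).toFinset.biUnion fun e => (succs_finite hlf e).toFinset := by
    ext e'
    simp [lvl_succ_eq hT]
  rw [lvlSum_apply, lvlSum_apply, hU, Finset.sum_biUnion]
  · refine Finset.sum_congr rfl fun e he => ?_
    have hel := (Set.Finite.mem_toFinset _).1 he
    have h1 : ∀ e' ∈ (succs_finite hlf e).toFinset, (z ^ (n + 1))⁻¹ * f e' * g (b e') =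
        (z ^ (n + 1))⁻¹ * g (b e) * f e' := by
      intro e' he'
      have hs := (Set.Finite.mem_toFinset _).1 he'
      rw [hg e hel (b e') (plusBd_succ_subset hT hs (hb e')) (b e) (hb e)]
      ring
    rw [Finset.sum_congr rfl h1, ← Finset.mul_sum, ← edgeLap_eq_sum hlf, hf e, pow_succ]
    field_simp
  · intro d hd d' hd' hne
    rw [Finset.mem_coe, Set.Finite.mem_toFinset] at hd hd'
    refine Finset.disjoint_left.2 fun e' h h' => hne ?_
    rw [Set.Finite.mem_toFinset] at h h'
    exact lvl_unique hT hd hd' (plusBd_succ_subset hT h (hb e')) (plusBd_succ_subset hT h' (hb e'))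

theorem lvlSum_of_le (hT : G.IsTree) (hlf : LocFin G) (o : X) {z : ℂ} (hz : z ≠ 0)
    {f : DE G → ℂ} (hf : f ∈ edgeEig G z) {b : DE G → Boundary G} (hb : ∀ e, b e ∈ plusBd G e)
    {n m : ℕ} (hnm : n ≤ m) {g : Boundary G → ℂ} (hg : IsLvlConst o n g) :
    lvlSum hT hlf o z f b m g = lvlSum hT hlf o z f b n g := by
  induction m, hnm using Nat.le_induction with
  | base => rfl
  | succ m hm ih => rw [lvlSum_succ hT hlf o hz hf hb (hg.mono hT hm), ih]

theorem lvlSum_edgeKernel (hT : G.IsTree) (hlf : LocFin G) (o : X) {z : ℂ} (hz : z ≠ 0)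
    (f : DE G → ℂ) {b : DE G → Boundary G} (hb : ∀ e, b e ∈ plusBd G e)
    {n : ℕ} {e : DE G} (he : e ∈ lvl o n) :
    lvlSum hT hlf o z f b n (edgeKernel o z e) = f e := by
  rw [lvlSum_apply, edgeKernel_of_mem_lvl hT z he, Finset.sum_eq_single e]
  · rw [indicator_of_mem (hb e)]
    field_simp
  · intro e' he' hne
    rw [indicator_of_notMem fun h =>
      hne (lvl_unique hT ((Set.Finite.mem_toFinset _).1 he') he (hb e') h), mul_zero]
  · exact fun h => absurd ((Set.Finite.mem_toFinset _).2 he) h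

theorem edgeEig_ext (hT : G.IsTree) (hlf : LocFin G) (o : X) {z : ℂ} (hz : z ≠ 0)
    {f f' : DE G → ℂ} (hf : f ∈ edgeEig G z) (hf' : f' ∈ edgeEig G z)
    (h : ∀ n, ∀ e ∈ lvl o n, f e = f' e) : f = f' := by
  refine funext fun e => edge_induction hT o (P := fun e => f e = f' e) h (fun e he => ?_) e
  refine mul_left_cancel₀ hz ?_
  rw [← hf e, ← hf' e, edgeLap_eq_sum hlf, edgeLap_eq_sum hlf]
  exact Finset.sum_congr rfl fun e' he' => he e' ((Set.Finite.mem_toFinset _).1 he')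

theorem exists_edgePoisson_eq (hT : G.IsTree) (hlf : LocFin G) (hnd : ∀ x : X, 2 ≤ deg G x)
    (o : X) {z : ℂ} (hz : z ≠ 0) {f : DE G → ℂ} (hf : f ∈ edgeEig G z) :
    ∃ μ : DualB G, edgePoisson G o z μ = f := by
  choose b hb using plusBd_nonempty hT hnd
  obtain ⟨μ, hμ⟩ := exists_eventual_limit
    (fun n => (lvlSum hT hlf o z f b n).comp (Clc G).subtype) fun g => by
      obtain ⟨n, hn⟩ := exists_isLvlConst hT hlf o g.2
      exact ⟨_, Filter.eventually_atTop.2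
        ⟨n, fun m hm => lvlSum_of_le hT hlf o hz hf hb hm hn⟩⟩
  refine ⟨μ, edgeEig_ext hT hlf o hz (edgePoisson_mem_edgeEig hT hlf o hz μ) hf fun n e he => ?_⟩
  have hconst : IsLvlConst o n (edgeKernel o z e) := by
    rw [edgeKernel_of_mem_lvl hT z he]
    exact isLvlConst_indicator hT he fun _ _ _ _ => rfl
  rw [edgePoisson_apply hT hlf o hz]
  obtain ⟨m, h1, hm⟩ := ((hμ ⟨edgeKernel o z e, edgeKernel_mem_Clc hT hlf o hz e⟩).and
    (Filter.eventually_ge_atTop n)).exists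
  rw [← h1]
  exact (lvlSum_of_le hT hlf o hz hf hb hm hconst).trans (lvlSum_edgeKernel hT hlf o hz f hb he)

end Tree

/-- The edge Poisson transform is a linear isomorphism from `D'(Ω)` onto
the `z`-eigenspace of the edge Laplacian. -/
theorem statement7 {X : Type} (G : SimpleGraph X) (hT : G.IsTree) (hlf : LocFin G)
    (hbd : ∃ D : ℕ, ∀ x : X, deg G x ≤ D) (hnd : ∀ x : X, 2 ≤ deg G x)
    (o : X) (z : ℂ) (hz : z ≠ 0) :
    (∀ μ ν : DualB G, edgePoisson G o z (μ + ν) =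
      fun e => edgePoisson G o z μ e + edgePoisson G o z ν e) ∧
    (∀ (c : ℂ) (μ : DualB G), edgePoisson G o z (c • μ) =
      fun e => c * edgePoisson G o z μ e) ∧
    Function.Injective (edgePoisson G o z) ∧
    Set.range (edgePoisson G o z) = edgeEig G z := by
  refine ⟨fun μ ν => ?_, fun c μ => ?_, edgePoisson_injective hT hlf hnd o hz, ?_⟩
  · ext e
    simp only [edgePoisson_apply hT hlf o hz, LinearMap.add_apply]
  · ext e
    simp only [edgePoisson_apply hT hlf o hz, LinearMap.smul_apply, smul_eq_mul]
  · refine Subset.antisymm ?_ fun f hf => exists_edgePoisson_eq hT hlf hnd o hz hf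
    rintro _ ⟨μ, rfl⟩
    exact edgePoisson_mem_edgeEig hT hlf o hz μ

end GraphQCC
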